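/- arXiv:2103.08270 — 4 statements merged into one kernel-verified Lean document; each statement's English description precedes it below -/
import Mathlib

section
/- (Outer-loop convergence of the Accelerated Inexact Proximal Forward-Backward algorithm, AIPFB.) Let g : ℝ^{d_x} → ℝ be μ_x-strongly convex and h : ℝ^{d_y} → ℝ be μ_y-strongly convex (μ_x, μ_y > 0), A : ℝ^{d_y} → ℝ^{d_x} linear with operator norm ‖A‖ > 0, and (x*, y*) the saddle point of f(x,y) = g(x) + ⟨x, Ay⟩ − h(y). Set γ = (1/‖A‖)√(μ_y/μ_x), σ = (1/‖A‖)√(μ_x/μ_y), θ = ‖A‖/(√(μ_x μ_y) + ‖A‖), ρ = √(μ_x μ_y)/(2√(μ_x μ_y) + 4‖A‖), C₀ = μ_x‖x₀ − x*‖² + μ_y‖y₀ − y*‖², ε_k = (C₀ρ(1 − θ)/16)(1 − ρ)^{k−1}, and C = ‖A‖/√(μ_x μ_y) + 1. Given (x₀, y₀), define x_{−1} = x₀ and for k ≥ 1: x̃_{k−1} = x_{k−1} + θ(x_{k−1} − x_{k−2}); y_k satisfies h_k(y_k) − min_y h_k(y) ≤ ε_k where h_k(y) = h(y) + (1/(2σ))‖y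 − y_{k−1} − σA^T x̃_{k−1}‖²; x_k satisfies g_k(x_k) − min_x g_k(x) ≤ ε_k where g_k(x) = g(x) + (1/(2γ))‖x − x_{k−1} + γAy_k‖². Then for every T ≥ 2: μ_x‖x_T − x*‖² + μ_y‖y_T − y*‖² ≤ C·(1 − ρ)^T·C₀. -/
open scoped RealInnerProductSpace

/-- An `ε`-minimizer `p` of a strongly convex function with a proximal term and a linear tilt
satisfies the strong convexity lower bound up to a factor `1 - t` and an error `ε / t`. -/
theorem StrongConvexOn.inexact_prox_le {E : Type*} [NormedAddCommGroup E] [InnerProductSpace ℝ E]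
    {f : E → ℝ} {μ c ε t : ℝ} (hf : StrongConvexOn Set.univ μ f) (ht : 0 < t) (ht1 : t ≤ 1)
    {p r d : E}
    (hp : ∀ v, f p + c / 2 * ‖p - r‖ ^ 2 - ⟪d, p⟫ ≤ f v + c / 2 * ‖v - r‖ ^ 2 - ⟪d, v⟫ + ε)
    (v : E) :
    f p + c / 2 * ‖p - r‖ ^ 2 - ⟪d, p⟫ + (1 - t) * ((μ + c) / 2 * ‖p - v‖ ^ 2) ≤
      f v + c / 2 * ‖v - r‖ ^ 2 - ⟪d, v⟫ + ε / t := by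
  have hconv := hf.2 (Set.mem_univ p) (Set.mem_univ v) (sub_nonneg.2 ht1) ht.le
    (sub_add_cancel 1 t)
  have hmin := hp ((1 - t) • p + t • v)
  have hnorm : ‖(1 - t) • p + t • v - r‖ ^ 2 =
      (1 - t) * ‖p - r‖ ^ 2 + t * ‖v - r‖ ^ 2 - t * (1 - t) * ‖p - v‖ ^ 2 := by
    have hz : (1 - t) • p + t • v - r = (1 - t) • (p - r) + t • (v - r) := by module
    have hpv : p - v = (p - r) - (v - r) := by abel
    rw [hz, hpv, norm_add_sq_real, norm_sub_sq_real (p - r), norm_smul, norm_smul, mul_pow,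
      mul_pow, real_inner_smul_left, real_inner_smul_right, Real.norm_eq_abs, Real.norm_eq_abs,
      sq_abs, sq_abs]
    ring
  simp only [smul_eq_mul] at hconv
  rw [hnorm, inner_add_right, real_inner_smul_right, real_inner_smul_right] at hmin
  refine le_of_mul_le_mul_left ?_ ht
  have hε : t * (ε / t) = ε := by field_simp
  rw [mul_add t _ (ε / t), hε]
  linarith

/-- Quadratic growth of a tilted strongly convex function at a minimizer. -/
theorem StrongConvexOn.quadratic_growth {E : Type*} [NormedAddCommGroup E]
    [InnerProductSpace ℝ E] {f : E → ℝ} {μ : ℝ} (hf : StrongConvexOn Set.univ μ f) {p d : E}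
    (hp : ∀ v, f p - ⟪d, p⟫ ≤ f v - ⟪d, v⟫) (v : E) :
    f p - ⟪d, p⟫ + μ / 2 * ‖p - v‖ ^ 2 ≤ f v - ⟪d, v⟫ := by
  have hlim : Filter.Tendsto (fun t : ℝ => f p - ⟪d, p⟫ + (1 - t) * (μ / 2 * ‖p - v‖ ^ 2))
      (nhdsWithin 0 (Set.Ioi 0)) (nhds (f p - ⟪d, p⟫ + μ / 2 * ‖p - v‖ ^ 2)) := by
    have hc : Continuous fun t : ℝ => f p - ⟪d, p⟫ + (1 - t) * (μ / 2 * ‖p - v‖ ^ 2) := by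
      fun_prop
    simpa using (hc.tendsto 0).mono_left nhdsWithin_le_nhds
  refine le_of_tendsto hlim ?_
  filter_upwards [Ioc_mem_nhdsGT (zero_lt_one' ℝ)] with t ht
  simpa using hf.inexact_prox_le (c := 0) (ε := 0) (r := 0) ht.1 ht.2 (by simpa using hp) v

/-- An `ε`-inexact proximal step with step size `σ` along `d`, compared with any point `v`. -/
theorem StrongConvexOn.inexact_prox_step {E : Type*} [NormedAddCommGroup E]
    [InnerProductSpace ℝ E] {f : E → ℝ} {μ σ ε t : ℝ} (hf : StrongConvexOn Set.univ μ f)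
    (hσ : σ ≠ 0) (ht : 0 < t) (ht1 : t ≤ 1) {p r d : E}
    (hp : ∀ v, f p + 1 / (2 * σ) * ‖p - r - σ • d‖ ^ 2 ≤
      f v + 1 / (2 * σ) * ‖v - r - σ • d‖ ^ 2 + ε) (v : E) :
    f p + σ⁻¹ / 2 * ‖p - r‖ ^ 2 - ⟪d, p⟫ + (1 - t) * ((μ + σ⁻¹) / 2 * ‖p - v‖ ^ 2) ≤
      f v + σ⁻¹ / 2 * ‖v - r‖ ^ 2 - ⟪d, v⟫ + ε / t := by
  refine hf.inexact_prox_le ht ht1 (fun w => ?_) v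
  have hexp (u : E) : 1 / (2 * σ) * ‖u - r - σ • d‖ ^ 2 =
      σ⁻¹ / 2 * ‖u - r‖ ^ 2 - ⟪d, u⟫ + (⟪d, r⟫ + σ / 2 * ‖d‖ ^ 2) := by
    rw [norm_sub_sq_real (u - r), real_inner_smul_right, norm_smul, mul_pow, Real.norm_eq_abs,
      sq_abs, real_inner_comm, inner_sub_right]
    field_simp
    ring
  have hw := hp w
  rw [hexp, hexp] at hw
  linarith

/-- Weighted Young inequality for the bilinear form of an operator with `‖A‖ = L √(μx μy)`. -/
theorem abs_inner_apply_le_of_opNorm_eq {E F : Type*} [NormedAddCommGroup E]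
    [InnerProductSpace ℝ E] [NormedAddCommGroup F] [InnerProductSpace ℝ F] (A : F →L[ℝ] E)
    {μx μy L : ℝ} (hμx : 0 ≤ μx) (hμy : 0 ≤ μy) (hL : 0 ≤ L)
    (hA : ‖A‖ = L * Real.sqrt (μx * μy)) (u : E) (w : F) :
    |⟪u, A w⟫| ≤ L / 2 * (μx * ‖u‖ ^ 2 + μy * ‖w‖ ^ 2) := by
  have hyoung : Real.sqrt (μx * μy) * (‖u‖ * ‖w‖) ≤ (μx * ‖u‖ ^ 2 + μy * ‖w‖ ^ 2) / 2 := by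
    rw [Real.sqrt_mul hμx]
    nlinarith [sq_nonneg (Real.sqrt μx * ‖u‖ - Real.sqrt μy * ‖w‖), Real.sq_sqrt hμx,
      Real.sq_sqrt hμy]
  calc |⟪u, A w⟫| ≤ ‖u‖ * ‖A w‖ := abs_real_inner_le_norm _ _
    _ ≤ ‖u‖ * (‖A‖ * ‖w‖) := by gcongr; exact A.le_opNorm w
    _ = L * (Real.sqrt (μx * μy) * (‖u‖ * ‖w‖)) := by rw [hA]; ring
    _ ≤ L * ((μx * ‖u‖ ^ 2 + μy * ‖w‖ ^ 2) / 2) := by gcongr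
    _ = L / 2 * (μx * ‖u‖ ^ 2 + μy * ‖w‖ ^ 2) := by ring

/-- outer-loop convergence of AIPFB.
With `g` `μx`-strongly convex, `h` `μy`-strongly convex, `‖A‖ > 0`, `(x*, y*)` the saddle
point of `f(x,y) = g(x) + ⟪x, Ay⟫ − h(y)`, `γ = (1/‖A‖)√(μy/μx)`, `σ = (1/‖A‖)√(μx/μy)`,
`θ = ‖A‖/(√(μxμy) + ‖A‖)`, `ρ = √(μxμy)/(2√(μxμy) + 4‖A‖)`,
`C₀ = μx‖x₀ − x*‖² + μy‖y₀ − y*‖²`, `ε_k = (C₀ρ(1 − θ)/16)(1 − ρ)^{k−1}`,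
`C = ‖A‖/√(μxμy) + 1`, the AIPFB iterates with `ε_k`-inexact proximal steps satisfy,
for every `T ≥ 2`, `μx‖x_T − x*‖² + μy‖y_T − y*‖² ≤ C(1 − ρ)^T C₀`. -/
theorem stmt_15 {dx dy : ℕ}
    (g : EuclideanSpace ℝ (Fin dx) → ℝ) (h : EuclideanSpace ℝ (Fin dy) → ℝ)
    (μx μy : ℝ) (hμx : 0 < μx) (hμy : 0 < μy)
    (A : EuclideanSpace ℝ (Fin dy) →L[ℝ] EuclideanSpace ℝ (Fin dx)) (hA : 0 < ‖A‖)
    (hg : ConvexOn ℝ Set.univ (fun x => g x - μx / 2 * ‖x‖ ^ 2))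
    (hh : ConvexOn ℝ Set.univ (fun y => h y - μy / 2 * ‖y‖ ^ 2))
    (xs : EuclideanSpace ℝ (Fin dx)) (ys : EuclideanSpace ℝ (Fin dy))
    (hsaddle : ∀ (x : EuclideanSpace ℝ (Fin dx)) (y : EuclideanSpace ℝ (Fin dy)),
      g xs + ⟪xs, A y⟫ - h y ≤ g xs + ⟪xs, A ys⟫ - h ys ∧
      g xs + ⟪xs, A ys⟫ - h ys ≤ g x + ⟪x, A ys⟫ - h ys)
    (γ σ θ ρ C₀ C : ℝ) (ε : ℕ → ℝ)
    (x xt : ℕ → EuclideanSpace ℝ (Fin dx)) (y : ℕ → EuclideanSpace ℝ (Fin dy))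
    (hγ : γ = 1 / ‖A‖ * Real.sqrt (μy / μx))
    (hσ : σ = 1 / ‖A‖ * Real.sqrt (μx / μy))
    (hθ : θ = ‖A‖ / (Real.sqrt (μx * μy) + ‖A‖))
    (hρ : ρ = Real.sqrt (μx * μy) / (2 * Real.sqrt (μx * μy) + 4 * ‖A‖))
    (hC₀ : C₀ = μx * ‖x 0 - xs‖ ^ 2 + μy * ‖y 0 - ys‖ ^ 2)
    (hε : ∀ k : ℕ, ε k = C₀ * ρ * (1 - θ) / 16 * (1 - ρ) ^ (k - 1))
    (hC : C = ‖A‖ / Real.sqrt (μx * μy) + 1)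
    (hxt0 : xt 0 = x 0)
    (hxt : ∀ k : ℕ, xt (k + 1) = x (k + 1) + θ • (x (k + 1) - x k))
    (hy : ∀ (k : ℕ) (v : EuclideanSpace ℝ (Fin dy)),
      h (y (k + 1)) +
          1 / (2 * σ) * ‖y (k + 1) - y k - σ • (ContinuousLinearMap.adjoint A) (xt k)‖ ^ 2 ≤
        h v + 1 / (2 * σ) * ‖v - y k - σ • (ContinuousLinearMap.adjoint A) (xt k)‖ ^ 2 +
          ε (k + 1))
    (hx : ∀ (k : ℕ) (u : EuclideanSpace ℝ (Fin dx)),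
      g (x (k + 1)) + 1 / (2 * γ) * ‖x (k + 1) - x k + γ • A (y (k + 1))‖ ^ 2 ≤
        g u + 1 / (2 * γ) * ‖u - x k + γ • A (y (k + 1))‖ ^ 2 + ε (k + 1)) :
    ∀ T : ℕ, 2 ≤ T →
      μx * ‖x T - xs‖ ^ 2 + μy * ‖y T - ys‖ ^ 2 ≤ C * (1 - ρ) ^ T * C₀ := by
  have hs : 0 < Real.sqrt (μx * μy) := Real.sqrt_pos.2 (mul_pos hμx hμy)
  obtain ⟨L, hLdef⟩ : ∃ L, L = ‖A‖ / Real.sqrt (μx * μy) := ⟨_, rfl⟩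
  have hL : 0 < L := hLdef ▸ div_pos hA hs
  have hAL : ‖A‖ = L * Real.sqrt (μx * μy) := by rw [hLdef]; field_simp
  have hσ' : σ⁻¹ = L * μy := by
    rw [hσ, hLdef, Real.sqrt_div hμx.le, Real.sqrt_mul hμx.le]
    have := Real.sqrt_pos.2 hμx
    have := Real.sqrt_pos.2 hμy
    field_simp
    rw [Real.sq_sqrt hμy.le]
  have hγ' : γ⁻¹ = L * μx := by
    rw [hγ, hLdef, Real.sqrt_div hμy.le, Real.sqrt_mul hμx.le]
    have := Real.sqrt_pos.2 hμx
    have := Real.sqrt_pos.2 hμy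
    field_simp
    rw [Real.sq_sqrt hμx.le]
  have hσ0 : σ ≠ 0 := fun h0 => by simp [h0, hL.ne', hμy.ne'] at hσ'
  have hγ0 : γ ≠ 0 := fun h0 => by simp [h0, hL.ne', hμx.ne'] at hγ'
  have hθL : θ = L / (1 + L) := by rw [hθ, hAL]; field_simp
  have hρL : ρ = 1 / (2 + 4 * L) := by rw [hρ, hAL]; field_simp
  have hCL : C = 1 + L := by rw [hC, ← hLdef, add_comm]
  have hθ0 : 0 < θ := by rw [hθL]; positivity
  have hθ1 : 0 < 1 - θ := by rw [hθL, one_sub_div (by positivity)]; simp; positivity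
  have hC₀0 : 0 ≤ C₀ := by rw [hC₀]; positivity
  have hθL' : θ * (1 + L) = L := by rw [hθL]; field_simp
  have hρL' : ρ * (2 + 4 * L) = 1 := by rw [hρL]; field_simp
  have hρ0 : 0 < ρ := by rw [hρL]; positivity
  have hρ1 : ρ < 1 := by nlinarith
  have hg' : StrongConvexOn Set.univ μx g := strongConvexOn_iff_convex.2 hg
  have hh' : StrongConvexOn Set.univ μy h := strongConvexOn_iff_convex.2 hh
  have hxt' (k : ℕ) : xt k = x k + θ • (x k - x (k - 1)) := by
    cases k with
    | zero => simp [hxt0]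
    | succ k => exact hxt k
  have hyoung := abs_inner_apply_le_of_opNorm_eq A hμx.le hμy.le hL.le hAL
  obtain ⟨D, hD⟩ : ∃ D : ℕ → ℝ, ∀ k, D k = μx * ‖x k - xs‖ ^ 2 + μy * ‖y k - ys‖ ^ 2 :=
    ⟨_, fun _ => rfl⟩
  obtain ⟨Φ, hΦ⟩ : ∃ Φ : ℕ → ℝ, ∀ k, Φ k = (1 + L) / 2 * D k +
      ⟪x k - x (k - 1), A (y k - ys)⟫ + L / 2 * (μx * ‖x k - x (k - 1)‖ ^ 2) :=
    ⟨_, fun _ => rfl⟩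
  have hstep (k : ℕ) : Φ (k + 1) ≤ θ * Φ k + 2 * (ε (k + 1) / (1 - θ)) := by
    have hyk := hh'.inexact_prox_step hσ0 hθ1 (by linarith) (hy k) ys
    have hxk := hg'.inexact_prox_step (d := -A (y (k + 1))) hγ0 hθ1 (by linarith)
      (by simpa only [smul_neg, sub_neg_eq_add] using hx k) xs
    have hgrowy := hh'.quadratic_growth (p := ys) (d := ContinuousLinearMap.adjoint A xs)
      (fun v => by
        simp only [ContinuousLinearMap.adjoint_inner_left]
        linarith [(hsaddle xs v).1]) (y (k + 1))
    have hgrowx := hg'.quadratic_growth (p := xs) (d := -A ys)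
      (fun v => by
        simp only [inner_neg_left, real_inner_comm _ (A ys)]
        linarith [(hsaddle v ys).2]) (x (k + 1))
    have hcross := le_of_abs_le (hyoung (x k - x (k - 1)) (y (k + 1) - y k))
    have hcross' := mul_le_mul_of_nonneg_left hcross hθ0.le
    have hprox (m n : ℝ) : (1 - (1 - θ)) * ((m + L * m) / 2 * n) = L / 2 * (m * n) := by
      linear_combination m * n / 2 * hθL'
    have hcontr (m : ℝ) : θ * ((1 + L) / 2 * m) = L / 2 * m := by
      linear_combination m / 2 * hθL'
    have hdrop : 0 ≤ (1 - θ) * (L * μy) * ‖y (k + 1) - y k‖ ^ 2 := by positivity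
    rw [hσ', hprox] at hyk
    rw [hγ', hprox] at hxk
    rw [hΦ, hΦ, mul_add, mul_add, hcontr, hD, hD, Nat.add_sub_cancel]
    simp only [ContinuousLinearMap.adjoint_inner_left, inner_neg_left, real_inner_comm _ (A _),
      hxt', inner_add_left, inner_sub_left, real_inner_smul_left, map_sub, inner_sub_right,
      norm_sub_rev ys, norm_sub_rev xs] at hyk hxk hgrowy hgrowx hcross' ⊢
    linarith
  have hbound (k : ℕ) : Φ k ≤ (1 + L) / 2 * (1 - ρ) ^ k * C₀ := by
    induction k with
    | zero => simp [hΦ, hD, hC₀]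
    | succ k ih =>
      have hεk : 2 * (ε (k + 1) / (1 - θ)) = ρ / 8 * (1 - ρ) ^ k * C₀ := by
        rw [hε, Nat.add_sub_cancel]
        field_simp
        ring
      have hrate : θ * ((1 + L) / 2) + ρ / 8 ≤ (1 + L) / 2 * (1 - ρ) := by nlinarith
      calc Φ (k + 1) ≤ θ * Φ k + 2 * (ε (k + 1) / (1 - θ)) := hstep k
        _ ≤ θ * ((1 + L) / 2 * (1 - ρ) ^ k * C₀) + ρ / 8 * (1 - ρ) ^ k * C₀ := by
          rw [hεk]; gcongr
        _ = (θ * ((1 + L) / 2) + ρ / 8) * ((1 - ρ) ^ k * C₀) := by ring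
        _ ≤ (1 + L) / 2 * (1 - ρ) * ((1 - ρ) ^ k * C₀) :=
          mul_le_mul_of_nonneg_right hrate
            (mul_nonneg (pow_nonneg (sub_nonneg.2 hρ1.le) k) hC₀0)
        _ = (1 + L) / 2 * (1 - ρ) ^ (k + 1) * C₀ := by ring
  intro T _
  have hlow := neg_le_of_abs_le (hyoung (x T - x (T - 1)) (y T - ys))
  have hT := hbound T
  rw [hΦ, hD] at hT
  have hx0 : 0 ≤ L * (μx * ‖x T - xs‖ ^ 2) := by positivity
  rw [hCL]
  linarith
end

section
/- Let h : ℝ^{d_y} → ℝ be convex and differentiable, A : ℝ^{d_y} → ℝ^{d_x} linear with operator norm ‖A‖ > 0 and adjoint A^T, and let μ_x, μ_y > 0 and σ = (1/‖A‖)√(μ_x/μ_y). Let (x*, y*) satisfy ∇h(y*) = A^T x* (so that y* minimizes y ↦ h(y) + (1/(2σ))‖y − y* − σA^T x*‖²). Let θ ∈ [0, 1] and points x_{k−1}, x_{k−2} ∈ ℝ^{d_x}, y_{k−1} ∈ ℝ^{d_y} be given, set x̃_{k−1} = x_{k−1} + θ(x_{k−1} − x_{k−2}), and let y_k* be a minimizer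 of y ↦ h(y) + (1/(2σ))‖y − y_{k−1} − σA^T x̃_{k−1}‖². Then ‖y_{k−1} − y_k*‖² ≤ 6‖y_{k−1} − y*‖² + (32μ_x/μ_y)‖x_{k−1} − x*‖² + (8μ_x/μ_y)‖x_{k−2} − x*‖². -/
open scoped RealInnerProductSpace

/-- The gradient inequality for a convex function. -/
theorem ConvexOn.inner_gradient_le_sub {E : Type*} [NormedAddCommGroup E] [InnerProductSpace ℝ E]
    [CompleteSpace E] {f : E → ℝ} {g u : E} (hf : ConvexOn ℝ Set.univ f)
    (hg : HasGradientAt f g u) (v : E) : ⟪g, v - u⟫ ≤ f v - f u := by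
  have hc : ConvexOn ℝ Set.univ (f ∘ AffineMap.lineMap (k := ℝ) u v) := by
    simpa using hf.comp_affineMap (AffineMap.lineMap (k := ℝ) u v)
  have hd : HasDerivAt (f ∘ AffineMap.lineMap (k := ℝ) u v) ⟪g, v - u⟫ 0 := by
    have h1 : HasDerivAt (AffineMap.lineMap (k := ℝ) u v) (v - u) (0 : ℝ) :=
      AffineMap.hasDerivAt_lineMap
    have h2 : HasFDerivAt f (InnerProductSpace.toDual ℝ E g)
        (AffineMap.lineMap (k := ℝ) u v 0) := by
      simpa using hg.hasFDerivAt
    simpa using h2.comp_hasDerivAt 0 h1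
  have := hc.le_slope_of_hasDerivAt (Set.mem_univ 0) (Set.mem_univ 1) one_pos hd
  simpa [slope_def_field] using this

/-- The gradient of a convex function is monotone. -/
theorem ConvexOn.inner_gradient_sub_nonneg {E : Type*} [NormedAddCommGroup E]
    [InnerProductSpace ℝ E] [CompleteSpace E] {f : E → ℝ} {g₁ g₂ u v : E}
    (hf : ConvexOn ℝ Set.univ f) (hu : HasGradientAt f g₁ u) (hv : HasGradientAt f g₂ v) :
    0 ≤ ⟪g₁ - g₂, u - v⟫ := by
  have h1 := hf.inner_gradient_le_sub hu v
  have h2 := hf.inner_gradient_le_sub hv u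
  rw [← neg_sub u v, inner_neg_right] at h1
  rw [inner_sub_left]
  linarith

/-- First-order optimality for a proximal subproblem. -/
theorem HasGradientAt.eq_of_isMin_prox {E : Type*} [NormedAddCommGroup E]
    [InnerProductSpace ℝ E] [CompleteSpace E] {f : E → ℝ} {g u c : E} {σ : ℝ} (hσ : 0 < σ)
    (hg : HasGradientAt f g u)
    (hu : ∀ v, f u + 1 / (2 * σ) * ‖u - c‖ ^ 2 ≤ f v + 1 / (2 * σ) * ‖v - c‖ ^ 2) :
    σ • g = c - u := by
  have hmin : IsLocalMin (fun v => f v + 1 / (2 * σ) * ‖v - c‖ ^ 2) u :=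
    Filter.Eventually.of_forall hu
  have hd := hg.hasFDerivAt.add
    ((((hasFDerivAt_id u).sub_const c).norm_sq).const_mul (1 / (2 * σ)))
  have h0 := hmin.hasFDerivAt_eq_zero hd
  refine ext_inner_right ℝ fun w => ?_
  have hw := congrArg (fun L : E →L[ℝ] ℝ => L w) h0
  simp at hw
  rw [inner_sub_left, real_inner_smul_left]
  field_simp at hw
  linarith

theorem norm_sub_sq_le_of_inner_nonneg {E : Type*} [NormedAddCommGroup E]
    [InnerProductSpace ℝ E] {u w p : E} (h : 0 ≤ ⟪u + w - p, p⟫) :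
    ‖u - p‖ ^ 2 ≤ 6 * ‖u‖ ^ 2 + 4 * ‖w‖ ^ 2 := by
  have hp : ‖p‖ ≤ ‖u + w‖ := by
    rw [inner_sub_left, real_inner_self_eq_norm_sq] at h
    have := real_inner_le_norm (u + w) p
    by_contra! hlt
    nlinarith [norm_nonneg (u + w)]
  have h1 := parallelogram_law_with_norm ℝ u p
  have h2 := parallelogram_law_with_norm ℝ u w
  have h3 := pow_le_pow_left₀ (norm_nonneg p) hp 2
  nlinarith [mul_self_nonneg ‖u + p‖, mul_self_nonneg ‖u - w‖]

theorem norm_extrapolation_sub_sq_le {E : Type*} [NormedAddCommGroup E] [NormedSpace ℝ E]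
    {θ : ℝ} (hθ0 : 0 ≤ θ) (hθ1 : θ ≤ 1) (x y z : E) :
    ‖x + θ • (x - y) - z‖ ^ 2 ≤ 8 * ‖x - z‖ ^ 2 + 2 * ‖y - z‖ ^ 2 := by
  have h1 : x + θ • (x - y) - z = (1 + θ) • (x - z) - θ • (y - z) := by module
  have h2 : ‖x + θ • (x - y) - z‖ ≤ 2 * ‖x - z‖ + ‖y - z‖ := by
    rw [h1]
    refine (norm_sub_le _ _).trans ?_
    rw [norm_smul, norm_smul, Real.norm_of_nonneg hθ0, Real.norm_of_nonneg (by linarith)]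
    nlinarith [norm_nonneg (x - z), norm_nonneg (y - z)]
  have h3 := pow_le_pow_left₀ (norm_nonneg _) h2 2
  nlinarith [sq_nonneg (2 * ‖x - z‖ - ‖y - z‖)]

/-- For `h` convex differentiable with `∇h(y*) = Aᵀx*`,
`σ = (1/‖A‖)√(μx/μy)`, `x̃_{k−1} = x_{k−1} + θ(x_{k−1} − x_{k−2})` with `θ ∈ [0,1]`, and
`y_k*` a minimizer of `y ↦ h(y) + (1/(2σ))‖y − y_{k−1} − σAᵀx̃_{k−1}‖²`, one has
`‖y_{k−1} − y_k*‖² ≤ 6‖y_{k−1} − y*‖² + (32μx/μy)‖x_{k−1} − x*‖² + (8μx/μy)‖x_{k−2} − x*‖²`. -/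
theorem stmt_16 {dx dy : ℕ}
    (h : EuclideanSpace ℝ (Fin dy) → ℝ)
    (h' : EuclideanSpace ℝ (Fin dy) → EuclideanSpace ℝ (Fin dy))
    (hconv : ConvexOn ℝ Set.univ h)
    (hdiff : ∀ v, HasGradientAt h (h' v) v)
    (A : EuclideanSpace ℝ (Fin dy) →L[ℝ] EuclideanSpace ℝ (Fin dx)) (hA : 0 < ‖A‖)
    (μx μy σ : ℝ) (hμx : 0 < μx) (hμy : 0 < μy)
    (hσ : σ = 1 / ‖A‖ * Real.sqrt (μx / μy))
    (xs : EuclideanSpace ℝ (Fin dx)) (ys : EuclideanSpace ℝ (Fin dy))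
    (hopt : h' ys = (ContinuousLinearMap.adjoint A) xs)
    (θ : ℝ) (hθ0 : 0 ≤ θ) (hθ1 : θ ≤ 1)
    (xkm1 xkm2 : EuclideanSpace ℝ (Fin dx)) (ykm1 : EuclideanSpace ℝ (Fin dy))
    (xt : EuclideanSpace ℝ (Fin dx)) (hxt : xt = xkm1 + θ • (xkm1 - xkm2))
    (yks : EuclideanSpace ℝ (Fin dy))
    (hyks : ∀ v : EuclideanSpace ℝ (Fin dy),
      h yks + 1 / (2 * σ) * ‖yks - ykm1 - σ • (ContinuousLinearMap.adjoint A) xt‖ ^ 2 ≤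
        h v + 1 / (2 * σ) * ‖v - ykm1 - σ • (ContinuousLinearMap.adjoint A) xt‖ ^ 2) :
    ‖ykm1 - yks‖ ^ 2 ≤
      6 * ‖ykm1 - ys‖ ^ 2 + 32 * μx / μy * ‖xkm1 - xs‖ ^ 2 +
        8 * μx / μy * ‖xkm2 - xs‖ ^ 2 := by
  have hr : 0 < μx / μy := div_pos hμx hμy
  have hσ0 : 0 < σ := by rw [hσ]; positivity
  have hσA : (σ * ‖A‖) ^ 2 = μx / μy := by
    rw [hσ, mul_right_comm, one_div_mul_cancel hA.ne', one_mul, Real.sq_sqrt hr.le]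
  have hfoc : σ • h' yks = ykm1 + σ • (ContinuousLinearMap.adjoint A) xt - yks :=
    (hdiff yks).eq_of_isMin_prox hσ0 fun v => by simpa only [sub_sub] using hyks v
  have hmono : 0 ≤ ⟪(ykm1 - ys) + σ • (ContinuousLinearMap.adjoint A) (xt - xs) - (yks - ys),
      yks - ys⟫ := by
    have heq : (ykm1 - ys) + σ • (ContinuousLinearMap.adjoint A) (xt - xs) - (yks - ys) =
        σ • (h' yks - h' ys) := by
      rw [smul_sub, hfoc, hopt, map_sub, smul_sub]
      abel
    rw [heq, real_inner_smul_left]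
    exact mul_nonneg hσ0.le (hconv.inner_gradient_sub_nonneg (hdiff yks) (hdiff ys))
  have hmain := norm_sub_sq_le_of_inner_nonneg hmono
  rw [sub_sub_sub_cancel_right] at hmain
  have hw : ‖σ • (ContinuousLinearMap.adjoint A) (xt - xs)‖ ^ 2 ≤ μx / μy * ‖xt - xs‖ ^ 2 := by
    rw [← hσA, ← mul_pow, norm_smul, Real.norm_of_nonneg hσ0.le, mul_assoc]
    have hle := (ContinuousLinearMap.adjoint A).le_opNorm (xt - xs)
    rw [LinearIsometryEquiv.norm_map] at hle
    gcongr
  have hx := mul_le_mul_of_nonneg_left (norm_extrapolation_sub_sq_le hθ0 hθ1 xkm1 xkm2 xs) hr.le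
  rw [← hxt] at hx
  rw [mul_div_assoc, mul_div_assoc]
  linarith
end

section
/- (Inexact proximal step inequality.) Let h : ℝ^{d_y} → ℝ be differentiable and μ_y-strongly convex (μ_y > 0), let σ > 0, w ∈ ℝ^{d_y}, and define h̄(y) = h(y) + (1/(2σ))‖y − w‖². Let ȳ be the minimizer of h̄ and suppose ŷ ∈ ℝ^{d_y} satisfies h̄(ŷ) − h̄(ȳ) ≤ ε for some ε ≥ 0. Then for every y* ∈ ℝ^{d_y}: h(y*) ≥ h(ŷ) + (1/σ)⟨ŷ − w, ŷ − y*⟩ + (μ_y/4)‖ŷ − y*‖² − (2 + 2/(μ_y σ))·ε. -/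
open scoped RealInnerProductSpace

section ProximalStep

variable {E : Type*} [NormedAddCommGroup E] [InnerProductSpace ℝ E]

/-- First-order optimality condition for the proximal objective `h v + s / 2 * ‖v - w‖ ^ 2`. -/
theorem inner_gradient_add_eq_zero_of_proximal_min [CompleteSpace E] {h : E → ℝ} {g y w : E}
    {s : ℝ} (hg : HasGradientAt h g y)
    (hmin : ∀ v, h y + s / 2 * ‖y - w‖ ^ 2 ≤ h v + s / 2 * ‖v - w‖ ^ 2) (d : E) :
    ⟪g, d⟫ + s * ⟪y - w, d⟫ = 0 := by
  have hsq := (((hasFDerivAt_id y).sub_const w).norm_sq).const_mul (s / 2)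
  have hloc : IsLocalMin (fun v => h v + s / 2 * ‖v - w‖ ^ 2) y := Filter.Eventually.of_forall hmin
  have key := congrArg (fun L => L d) (hloc.hasFDerivAt_eq_zero (hg.hasFDerivAt.add hsq))
  simp at key
  rw [inner_sub_left]
  linarith

/-- A Young-type lower bound on `‖a + b‖ ^ 2` when `‖b‖ ^ 2` is small. -/
theorem norm_add_sq_lower_bound (a b : E) {m s ε : ℝ} (hm : 0 < m) (hs : 0 ≤ s)
    (hb : (m + s) / 2 * ‖b‖ ^ 2 ≤ ε) :
    (m / 4 + s / 2) * ‖a‖ ^ 2 - (1 + 2 * s / m) * ε ≤ (m + s) / 2 * ‖a + b‖ ^ 2 := by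
  have hsq : 0 ≤ m / 4 * ‖a + (2 * (m + s) / m) • b‖ ^ 2 := by positivity
  have hexp : m / 4 * ‖a + (2 * (m + s) / m) • b‖ ^ 2 =
      m / 4 * ‖a‖ ^ 2 + (m + s) * ⟪a, b⟫ + (2 + 2 * s / m) * ((m + s) / 2 * ‖b‖ ^ 2) := by
    rw [norm_add_sq_real, real_inner_smul_right, norm_smul, mul_pow, Real.norm_eq_abs, sq_abs]
    field_simp
    ring
  have hle := mul_le_mul_of_nonneg_left hb (by positivity : 0 ≤ 1 + 2 * s / m)
  rw [norm_add_sq_real]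
  linarith

end ProximalStep

/-- inexact proximal step inequality.
For `h` differentiable and `μy`-strongly convex, `σ > 0`, `h̄(y) = h(y) + (1/(2σ))‖y − w‖²`
with minimizer `ȳ`, and `ŷ` with `h̄(ŷ) − h̄(ȳ) ≤ ε`, for every `y*`:
`h(y*) ≥ h(ŷ) + (1/σ)⟪ŷ − w, ŷ − y*⟫ + (μy/4)‖ŷ − y*‖² − (2 + 2/(μyσ))ε`. -/
theorem stmt_18 {dy : ℕ}
    (h : EuclideanSpace ℝ (Fin dy) → ℝ)
    (h' : EuclideanSpace ℝ (Fin dy) → EuclideanSpace ℝ (Fin dy))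
    (μy : ℝ) (hμy : 0 < μy)
    (hdiff : ∀ v, HasGradientAt h (h' v) v)
    (hsc : ∀ v₁ v₂, h v₂ ≥ h v₁ + ⟪h' v₁, v₂ - v₁⟫ + μy / 2 * ‖v₂ - v₁‖ ^ 2)
    (σ : ℝ) (hσ : 0 < σ) (w : EuclideanSpace ℝ (Fin dy))
    (ybar : EuclideanSpace ℝ (Fin dy))
    (hybar : ∀ v : EuclideanSpace ℝ (Fin dy),
      h ybar + 1 / (2 * σ) * ‖ybar - w‖ ^ 2 ≤ h v + 1 / (2 * σ) * ‖v - w‖ ^ 2)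
    (yhat : EuclideanSpace ℝ (Fin dy)) (ε : ℝ) (hε : 0 ≤ ε)
    (hyhat : h yhat + 1 / (2 * σ) * ‖yhat - w‖ ^ 2 -
      (h ybar + 1 / (2 * σ) * ‖ybar - w‖ ^ 2) ≤ ε)
    (ystar : EuclideanSpace ℝ (Fin dy)) :
    h ystar ≥ h yhat + 1 / σ * ⟪yhat - w, yhat - ystar⟫ +
      μy / 4 * ‖yhat - ystar‖ ^ 2 - (2 + 2 / (μy * σ)) * ε := by
  have hopt := inner_gradient_add_eq_zero_of_proximal_min (s := 1 / σ) (w := w) (hdiff ybar)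
    (fun v => by simpa only [div_div, mul_comm σ 2] using hybar v)
  have hpol (v z : EuclideanSpace ℝ (Fin dy)) :
      ‖v - w‖ ^ 2 = ‖z - w‖ ^ 2 + 2 * ⟪z - w, v - z⟫ + ‖v - z‖ ^ 2 := by
    rw [← norm_add_sq_real, add_comm, sub_add_sub_cancel]
  have hs : 1 / (2 * σ) = 1 / σ / 2 := by rw [div_div, mul_comm]
  have hgrow (v : EuclideanSpace ℝ (Fin dy)) :
      h ybar + 1 / (2 * σ) * ‖ybar - w‖ ^ 2 + (μy + 1 / σ) / 2 * ‖v - ybar‖ ^ 2 ≤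
        h v + 1 / (2 * σ) * ‖v - w‖ ^ 2 := by
    rw [hpol v ybar, hs]
    linarith [hsc ybar v, hopt (v - ybar)]
  have hyoung := norm_add_sq_lower_bound (ystar - yhat) (yhat - ybar) hμy
    (by positivity : 0 ≤ 1 / σ) (by linarith [hgrow yhat] :
      (μy + 1 / σ) / 2 * ‖yhat - ybar‖ ^ 2 ≤ ε)
  rw [sub_add_sub_cancel] at hyoung
  have hstar := hgrow ystar
  have hc : 2 / (μy * σ) = 2 * (1 / σ) / μy := by field_simp
  rw [hpol ystar yhat] at hstar
  rw [← neg_sub ystar yhat, inner_neg_right, norm_neg, hc]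
  rw [hs] at hstar hyhat
  linarith
end

section
/- (One-step contraction of the APFB Lyapunov function.) In the setting of the APFB algorithm — g μ_x-strongly convex, h μ_y-strongly convex, A linear with ‖A‖ > 0, (x*, y*) the saddle point of f(x,y) = g(x) + ⟨x, Ay⟩ − h(y), γ = (1/‖A‖)√(μ_y/μ_x), σ = (1/‖A‖)√(μ_x/μ_y), θ = ‖A‖/(√(μ_x μ_y) + ‖A‖) — suppose that for a given k ≥ 1 the points x_{k−2}, x_{k−1}, y_{k−1} are given, x̃_{k−1} = x_{k−1} + θ(x_{k−1} − x_{k−2}), y_k is the minimizer of v ↦ h(v) + (1/(2σ))‖v − y_{k−1} − σA^T x̃_{k−1}‖², and x_k is the minimizer of u ↦ g(u) + (1/(2γ))‖u − x_{k−1} + γAy_k‖². Define b_k = (μ_x/2 + 1/(2γ))‖x_k − x*‖² + (μ_y/2 + 1/(2σ))‖y_k − y*‖² + (1/(2γ))‖x_k − x_{k−1}‖² + ⟨x_k − x_{k−1}, A(y_k − y*)⟩, and b_{k−1} the same expression with indices shifted down by one. Then b_k ≤ θ·b_{k−1}. -/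
open scoped RealInnerProductSpace

/-- Quadratic growth of `f + b‖· - c‖²` around its minimizer, for `f` strongly convex. -/
lemma StrongConvexOn.add_sq_le_of_forall_le {E : Type*} [NormedAddCommGroup E]
    [InnerProductSpace ℝ E] {f : E → ℝ} {m b : ℝ} (hf : StrongConvexOn Set.univ m f)
    {c z : E} (hz : ∀ v, f z + b * ‖z - c‖ ^ 2 ≤ f v + b * ‖v - c‖ ^ 2)
    (v : E) :
    f z + b * ‖z - c‖ ^ 2 + (m / 2 + b) * ‖v - z‖ ^ 2 ≤ f v + b * ‖v - c‖ ^ 2 := by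
  set M := (m / 2 + b) * ‖v - z‖ ^ 2 with hM
  by_contra! hlt
  set D := f z + b * ‖z - c‖ ^ 2 + M - (f v + b * ‖v - c‖ ^ 2) with hD
  have hD0 : 0 < D := by linarith
  have hDM : D ≤ M := by linarith [hz v]
  have hM1 : 0 < M := hD0.trans_le hDM
  obtain ⟨t, ht0, ht1, htM⟩ : ∃ t : ℝ, 0 < t ∧ t < 1 ∧ t * M < D := by
    refine ⟨D / (2 * M), by positivity, ?_, ?_⟩
    · rw [div_lt_one (by positivity)]
      linarith
    · field_simp
      linarith
  have hconv := hf.2 (Set.mem_univ z) (Set.mem_univ v) (sub_nonneg.2 ht1.le) ht0.le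
    (sub_add_cancel 1 t)
  have hmin := hz ((1 - t) • z + t • v)
  have hsq : ‖(1 - t) • z + t • v - c‖ ^ 2 =
      (1 - t) * ‖z - c‖ ^ 2 + t * ‖v - c‖ ^ 2 - t * (1 - t) * ‖v - z‖ ^ 2 := by
    have h₁ : (1 - t) • z + t • v - c = (1 - t) • (z - c) + t • (v - c) := by module
    have h₂ : v - z = (v - c) - (z - c) := by abel
    rw [h₁, h₂, norm_add_sq_real, norm_sub_sq_real (v - c), norm_smul, norm_smul, mul_pow, mul_pow,
      inner_smul_left, inner_smul_right, real_inner_comm (z - c) (v - c)]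
    simp only [Real.norm_eq_abs, sq_abs, conj_trivial]
    ring
  rw [hsq] at hmin
  simp only [smul_eq_mul, norm_sub_rev z v] at hconv
  have hpos : 0 < t * (D - t * M) := mul_pos ht0 (sub_pos.2 htM)
  have hle : t * (D - t * M) ≤ 0 := by
    rw [hD, hM]
    linarith
  exact hle.not_gt hpos

/-- one-step contraction of the APFB Lyapunov function.
In the APFB setting, with `b_k = (μx/2 + 1/(2γ))‖x_k − x*‖² + (μy/2 + 1/(2σ))‖y_k − y*‖²
+ (1/(2γ))‖x_k − x_{k−1}‖² + ⟪x_k − x_{k−1}, A(y_k − y*)⟫` and `b_{k−1}` the same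
expression with indices shifted down by one, one has `b_k ≤ θ·b_{k−1}`. -/
theorem stmt_19 {dx dy : ℕ}
    (g : EuclideanSpace ℝ (Fin dx) → ℝ) (h : EuclideanSpace ℝ (Fin dy) → ℝ)
    (μx μy : ℝ) (hμx : 0 < μx) (hμy : 0 < μy)
    (A : EuclideanSpace ℝ (Fin dy) →L[ℝ] EuclideanSpace ℝ (Fin dx)) (hA : 0 < ‖A‖)
    (hg : ConvexOn ℝ Set.univ (fun x => g x - μx / 2 * ‖x‖ ^ 2))
    (hh : ConvexOn ℝ Set.univ (fun y => h y - μy / 2 * ‖y‖ ^ 2))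
    (xs : EuclideanSpace ℝ (Fin dx)) (ys : EuclideanSpace ℝ (Fin dy))
    (hsaddle : ∀ (x : EuclideanSpace ℝ (Fin dx)) (y : EuclideanSpace ℝ (Fin dy)),
      g xs + ⟪xs, A y⟫ - h y ≤ g xs + ⟪xs, A ys⟫ - h ys ∧
      g xs + ⟪xs, A ys⟫ - h ys ≤ g x + ⟪x, A ys⟫ - h ys)
    (γ σ θ : ℝ)
    (hγ : γ = 1 / ‖A‖ * Real.sqrt (μy / μx))
    (hσ : σ = 1 / ‖A‖ * Real.sqrt (μx / μy))
    (hθ : θ = ‖A‖ / (Real.sqrt (μx * μy) + ‖A‖))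
    (xkm2 xkm1 : EuclideanSpace ℝ (Fin dx)) (ykm1 : EuclideanSpace ℝ (Fin dy))
    (xt : EuclideanSpace ℝ (Fin dx)) (hxt : xt = xkm1 + θ • (xkm1 - xkm2))
    (yk : EuclideanSpace ℝ (Fin dy))
    (hyk : ∀ v : EuclideanSpace ℝ (Fin dy),
      h yk + 1 / (2 * σ) * ‖yk - ykm1 - σ • (ContinuousLinearMap.adjoint A) xt‖ ^ 2 ≤
        h v + 1 / (2 * σ) * ‖v - ykm1 - σ • (ContinuousLinearMap.adjoint A) xt‖ ^ 2)
    (xk : EuclideanSpace ℝ (Fin dx))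
    (hxk : ∀ u : EuclideanSpace ℝ (Fin dx),
      g xk + 1 / (2 * γ) * ‖xk - xkm1 + γ • A yk‖ ^ 2 ≤
        g u + 1 / (2 * γ) * ‖u - xkm1 + γ • A yk‖ ^ 2) :
    (μx / 2 + 1 / (2 * γ)) * ‖xk - xs‖ ^ 2 + (μy / 2 + 1 / (2 * σ)) * ‖yk - ys‖ ^ 2 +
        1 / (2 * γ) * ‖xk - xkm1‖ ^ 2 + ⟪xk - xkm1, A (yk - ys)⟫ ≤
      θ * ((μx / 2 + 1 / (2 * γ)) * ‖xkm1 - xs‖ ^ 2 +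
        (μy / 2 + 1 / (2 * σ)) * ‖ykm1 - ys‖ ^ 2 +
        1 / (2 * γ) * ‖xkm1 - xkm2‖ ^ 2 + ⟪xkm1 - xkm2, A (ykm1 - ys)⟫) := by
  obtain ⟨p, hp, rfl⟩ : ∃ p : ℝ, 0 < p ∧ μx = p ^ 2 :=
    ⟨√μx, Real.sqrt_pos.2 hμx, (Real.sq_sqrt hμx.le).symm⟩
  obtain ⟨q, hq, rfl⟩ : ∃ q : ℝ, 0 < q ∧ μy = q ^ 2 :=
    ⟨√μy, Real.sqrt_pos.2 hμy, (Real.sq_sqrt hμy.le).symm⟩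
  rw [← div_pow, Real.sqrt_sq (by positivity)] at hγ hσ
  rw [← mul_pow, Real.sqrt_sq (by positivity)] at hθ
  have hγ0 : 0 < γ := by rw [hγ]; positivity
  have hσ0 : 0 < σ := by rw [hσ]; positivity
  have hθ0 : 0 < θ := by rw [hθ]; positivity
  have hθ1 : θ ≤ 1 := by
    rw [hθ, div_le_one (by positivity)]
    linarith [mul_pos hp hq]
  have hθx : θ * (p ^ 2 / 2 + 1 / (2 * γ)) = 1 / (2 * γ) := by
    rw [hθ, hγ]
    field_simp
  have hθy : θ * (q ^ 2 / 2 + 1 / (2 * σ)) = 1 / (2 * σ) := by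
    rw [hθ, hσ]
    field_simp
  have hab : 4 * (1 / (2 * γ)) * (1 / (2 * σ)) = ‖A‖ ^ 2 := by
    rw [hγ, hσ]
    field_simp
    norm_num
  have hγa : 2 * (1 / (2 * γ)) * γ = 1 := by field_simp
  have hσb : 2 * (1 / (2 * σ)) * σ = 1 := by field_simp
  have ha : 0 < 1 / (2 * γ) := by positivity
  have hb : 0 < 1 / (2 * σ) := by positivity
  generalize 1 / (2 * γ) = a at *
  generalize 1 / (2 * σ) = b at *
  simp only [sub_sub] at hyk
  simp only [sub_add] at hxk
  have hX := (strongConvexOn_iff_convex.2 hg).add_sq_le_of_forall_le hxk xs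
  have hY := (strongConvexOn_iff_convex.2 hh).add_sq_le_of_forall_le hyk ys
  have hsy := (hsaddle xs yk).1
  have hsx := (hsaddle xk ys).2
  have hX' : a * ‖xk - (xkm1 - γ • A yk)‖ ^ 2 - a * ‖xs - (xkm1 - γ • A yk)‖ ^ 2 =
      a * ‖xk - xkm1‖ ^ 2 - a * ‖xkm1 - xs‖ ^ 2 + ⟪xk - xs, A yk⟫ := by
    rw [← sub_add, ← sub_add, norm_add_sq_real, norm_add_sq_real, norm_sub_rev xkm1 xs]
    simp only [inner_smul_right, inner_sub_left]
    linear_combination (⟪xk, A yk⟫ - ⟪xs, A yk⟫) * hγa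
  have hY' : b * ‖yk - (ykm1 + σ • (ContinuousLinearMap.adjoint A) xt)‖ ^ 2 -
      b * ‖ys - (ykm1 + σ • (ContinuousLinearMap.adjoint A) xt)‖ ^ 2 =
      b * ‖yk - ykm1‖ ^ 2 - b * ‖ykm1 - ys‖ ^ 2 - ⟪xt, A (yk - ys)⟫ := by
    rw [← sub_sub, ← sub_sub, norm_sub_sq_real (yk - ykm1),
      norm_sub_sq_real (ys - ykm1), norm_sub_rev ykm1 ys]
    simp only [inner_smul_right, ContinuousLinearMap.adjoint_inner_right,
      map_sub, inner_sub_right, real_inner_comm xt]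
    linear_combination (⟪xt, A ys⟫ - ⟪xt, A yk⟫) * hσb
  have hcross : θ * ⟪xkm1 - xkm2, A (yk - ykm1)⟫ ≤
      θ * (a * ‖xkm1 - xkm2‖ ^ 2) + b * ‖yk - ykm1‖ ^ 2 := by
    have hcs : ⟪xkm1 - xkm2, A (yk - ykm1)⟫ ≤ ‖xkm1 - xkm2‖ * (‖A‖ * ‖yk - ykm1‖) :=
      (real_inner_le_norm _ _).trans (by gcongr; exact A.le_opNorm _)
    have hyoung : θ * (‖xkm1 - xkm2‖ * (‖A‖ * ‖yk - ykm1‖)) ≤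
        θ ^ 2 * (a * ‖xkm1 - xkm2‖ ^ 2) + b * ‖yk - ykm1‖ ^ 2 := by
      refine le_of_mul_le_mul_left ?_ (by positivity : 0 < 4 * a)
      linear_combination sq_nonneg (2 * a * θ * ‖xkm1 - xkm2‖ - ‖A‖ * ‖yk - ykm1‖) -
        ‖yk - ykm1‖ ^ 2 * hab
    have hθsq : θ ^ 2 * (a * ‖xkm1 - xkm2‖ ^ 2) ≤ θ * (a * ‖xkm1 - xkm2‖ ^ 2) := by
      gcongr
      nlinarith
    linarith [mul_le_mul_of_nonneg_left hcs hθ0.le]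
  rw [norm_sub_rev xs xk] at hX
  rw [norm_sub_rev ys yk] at hY
  subst hxt
  simp only [map_sub, inner_sub_left, inner_sub_right, inner_add_left, real_inner_smul_left]
    at hX' hY' hcross hsx hsy ⊢
  linear_combination hX + hY + hsy + hsx + hcross - hX' - hY' -
    ‖xkm1 - xs‖ ^ 2 * hθx - ‖ykm1 - ys‖ ^ 2 * hθy
end
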